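/- Let π_n, η_n, π* be policies, β ∈ (0,1], and ξ ≥ 0. Let π'_{n+1} = (1−β)π_n + βπ*_n denote the state-wise mixture policy, i.e., π'_{n+1}(a|s) = (1−β)π_n(a|s) + βπ*_n(a|s). If E_{s∼d_{π_n}}[E_{a∼π'_{n+1}(·|s)}[A^{η_n}(s,a)]] ≥ −ξ and Δ := J(π_n) − J(η_n) ≥ 0, then E_{s∼d_{π_n}}[E_{a∼π*_n(·|s)}[A^{η_n}(s,a)]] ≥ −ξ/β − (1−γ)Δ/β. -/

import Mathlib

open scoped BigOperators

noncomputable section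

/-- `p` is a probability distribution on a finite type. -/
def IsDist {X : Type*} [Fintype X] (p : X → ℝ) : Prop :=
  (∀ x, 0 ≤ p x) ∧ ∑ x, p x = 1

/-- `P` is a transition dynamics: `P s a` is a distribution over next states. -/
def IsDynamics {S A : Type*} [Fintype S] (P : S → A → S → ℝ) : Prop :=
  ∀ s a, IsDist (P s a)

/-- `π` is a (stochastic) policy: `π s` is a distribution over actions. -/
def IsPolicy {S A : Type*} [Fintype A] (π : S → A → ℝ) : Prop :=
  ∀ s, IsDist (π s)

/-- One-step evolution of a state distribution under policy `π` and dynamics `P`. -/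
def step {S A : Type*} [Fintype S] [Fintype A]
    (P : S → A → S → ℝ) (π : S → A → ℝ) (d : S → ℝ) : S → ℝ :=
  fun s' => ∑ s, ∑ a, d s * π s a * P s a s'

/-- The time-`t` state distribution `d_π^t` starting from `ρ₀`. -/
def stateDist {S A : Type*} [Fintype S] [Fintype A]
    (P : S → A → S → ℝ) (π : S → A → ℝ) (ρ₀ : S → ℝ) : ℕ → S → ℝ
  | 0 => ρ₀
  | t + 1 => step P π (stateDist P π ρ₀ t)

/-- Discounted state visitation distribution `d_π = (1-γ) Σ_t γ^t d_π^t`. -/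
def visit {S A : Type*} [Fintype S] [Fintype A]
    (γ : ℝ) (P : S → A → S → ℝ) (π : S → A → ℝ) (ρ₀ : S → ℝ) : S → ℝ :=
  fun s => (1 - γ) * ∑' t : ℕ, γ ^ t * stateDist P π ρ₀ t s

/-- Expected cost of one step when the state is distributed as `d` and actions follow `π`. -/
def expCost {S A : Type*} [Fintype S] [Fintype A]
    (c : S → A → ℝ) (π : S → A → ℝ) (d : S → ℝ) : ℝ :=
  ∑ s, ∑ a, d s * π s a * c s a

/-- Value function `V^π(s₀)`: expected total discounted cost starting at `s₀`. -/
def Vf {S A : Type*} [Fintype S] [Fintype A] [DecidableEq S]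
    (γ : ℝ) (P : S → A → S → ℝ) (c : S → A → ℝ) (π : S → A → ℝ) (s₀ : S) : ℝ :=
  ∑' t : ℕ, γ ^ t * expCost c π (stateDist P π (fun s => if s = s₀ then 1 else 0) t)

/-- Objective `J(π) = E_{s∼ρ₀}[V^π(s)]`. -/
def Jf {S A : Type*} [Fintype S] [Fintype A] [DecidableEq S]
    (γ : ℝ) (P : S → A → S → ℝ) (c : S → A → ℝ) (ρ₀ : S → ℝ) (π : S → A → ℝ) : ℝ :=
  ∑ s, ρ₀ s * Vf γ P c π s

/-- State-action value `Q^π(s,a) = c(s,a) + γ E_{s'∼P_{s,a}}[V^π(s')]`. -/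
def Qf {S A : Type*} [Fintype S] [Fintype A] [DecidableEq S]
    (γ : ℝ) (P : S → A → S → ℝ) (c : S → A → ℝ) (π : S → A → ℝ) (s : S) (a : A) : ℝ :=
  c s a + γ * ∑ s', P s a s' * Vf γ P c π s'

/-- Disadvantage function `A^π(s,a) = Q^π(s,a) - V^π(s)`. -/
def Adv {S A : Type*} [Fintype S] [Fintype A] [DecidableEq S]
    (γ : ℝ) (P : S → A → S → ℝ) (c : S → A → ℝ) (π : S → A → ℝ) (s : S) (a : A) : ℝ :=
  Qf γ P c π s a - Vf γ P c π s

section Occupancy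

variable {S A : Type*} [Fintype S] [Fintype A]
  {γ : ℝ} {P : S → A → S → ℝ} {π : S → A → ℝ} {ρ₀ : S → ℝ}

theorem sum_step_mul (P : S → A → S → ℝ) (π : S → A → ℝ) (d f : S → ℝ) :
    ∑ s', step P π d s' * f s' = ∑ s, d s * ∑ a, π s a * ∑ s', P s a s' * f s' := by
  simp only [step, Finset.sum_mul, Finset.mul_sum]
  rw [Finset.sum_comm]
  refine Finset.sum_congr rfl fun s _ => ?_
  rw [Finset.sum_comm]
  simp only [mul_assoc]

theorem IsDist.step (hP : IsDynamics P) (hπ : IsPolicy π) {d : S → ℝ} (hd : IsDist d) :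
    IsDist (step P π d) := by
  refine ⟨fun s' => Finset.sum_nonneg fun s _ => Finset.sum_nonneg fun a _ =>
    mul_nonneg (mul_nonneg (hd.1 s) ((hπ s).1 a)) ((hP s a).1 s'), ?_⟩
  simpa [(hP _ _).2, (hπ _).2, hd.2] using sum_step_mul P π d fun _ => 1

theorem IsDist.stateDist (hP : IsDynamics P) (hπ : IsPolicy π) (hρ : IsDist ρ₀) (t : ℕ) :
    IsDist (stateDist P π ρ₀ t) := by
  induction t with
  | zero => exact hρ
  | succ t ih => exact ih.step hP hπ

theorem IsDist.le_one {X : Type*} [Fintype X] {p : X → ℝ} (hp : IsDist p) (x : X) : p x ≤ 1 :=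
  hp.2 ▸ Finset.single_le_sum (fun y _ => hp.1 y) (Finset.mem_univ x)

theorem summable_discounted_stateDist (hγ : 0 ≤ γ) (hγ' : γ < 1) (hP : IsDynamics P)
    (hπ : IsPolicy π) (hρ : IsDist ρ₀) (s : S) :
    Summable fun t : ℕ => γ ^ t * stateDist P π ρ₀ t s :=
  Summable.of_nonneg_of_le
    (fun t => mul_nonneg (pow_nonneg hγ t) ((hρ.stateDist hP hπ t).1 s))
    (fun t => mul_le_of_le_one_right (pow_nonneg hγ t) ((hρ.stateDist hP hπ t).le_one s))
    (summable_geometric_of_lt_one hγ hγ')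

/-- Discounted expectations of a function of the state are integrals against the visitation
distribution. -/
theorem hasSum_discounted_expectation (hγ : 0 ≤ γ) (hγ' : γ < 1) (hP : IsDynamics P)
    (hπ : IsPolicy π) (hρ : IsDist ρ₀) (f : S → ℝ) :
    HasSum (fun t : ℕ => (1 - γ) * (γ ^ t * ∑ s, stateDist P π ρ₀ t s * f s))
      (∑ s, visit γ P π ρ₀ s * f s) := by
  have h := hasSum_sum (s := Finset.univ) fun s _ =>
    (((summable_discounted_stateDist hγ hγ' hP hπ hρ s).hasSum.mul_left (1 - γ)).mul_right (f s))
  refine h.congr_fun fun t => ?_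
  simp only [Finset.mul_sum, mul_assoc]

/-- The flow equation satisfied by the visitation distribution, tested against `f`. -/
theorem sum_visit_mul (hγ : 0 ≤ γ) (hγ' : γ < 1) (hP : IsDynamics P)
    (hπ : IsPolicy π) (hρ : IsDist ρ₀) (f : S → ℝ) :
    ∑ s, visit γ P π ρ₀ s * f s = (1 - γ) * ∑ s, ρ₀ s * f s +
      γ * ∑ s, visit γ P π ρ₀ s * ∑ a, π s a * ∑ s', P s a s' * f s' := by
  have h := hasSum_discounted_expectation hγ hγ' hP hπ hρ f
  have h' := (hasSum_discounted_expectation hγ hγ' hP hπ hρ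
    fun s => ∑ a, π s a * ∑ s', P s a s' * f s').mul_left γ
  rw [← h.tsum_eq, h.summable.tsum_eq_zero_add, ← h'.tsum_eq]
  congr 1
  · simp [stateDist]
  · refine tsum_congr fun t => ?_
    rw [stateDist, sum_step_mul]
    ring

theorem expCost_eq (c : S → A → ℝ) (π : S → A → ℝ) (d : S → ℝ) :
    expCost c π d = ∑ s, d s * ∑ a, π s a * c s a := by
  simp only [expCost, Finset.mul_sum, mul_assoc]

variable [DecidableEq S]

theorem isDist_indicator (s₀ : S) : IsDist fun s => if s = s₀ then (1 : ℝ) else 0 :=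
  ⟨fun s => by positivity, by simp⟩

theorem stateDist_eq_sum (P : S → A → S → ℝ) (π : S → A → ℝ) (ρ₀ : S → ℝ) (t : ℕ) (s : S) :
    stateDist P π ρ₀ t s =
      ∑ s₀, ρ₀ s₀ * stateDist P π (fun s => if s = s₀ then 1 else 0) t s := by
  induction t generalizing s with
  | zero => simp [stateDist]
  | succ t ih =>
    simp only [stateDist, step, ih, Finset.sum_mul, Finset.mul_sum]
    rw [Finset.sum_comm_cycle]
    simp only [mul_assoc]

/-- The objective is the expected cost under the visitation distribution. -/
theorem one_sub_mul_Jf (hγ : 0 ≤ γ) (hγ' : γ < 1) (hP : IsDynamics P)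
    (hπ : IsPolicy π) (hρ : IsDist ρ₀) (c : S → A → ℝ) :
    (1 - γ) * Jf γ P c ρ₀ π = ∑ s, visit γ P π ρ₀ s * ∑ a, π s a * c s a := by
  have hV (s₀ : S) := hasSum_discounted_expectation hγ hγ' hP hπ (isDist_indicator s₀)
    fun s => ∑ a, π s a * c s a
  have hVf (s₀ : S) : (1 - γ) * Vf γ P c π s₀ =
      ∑ s, visit γ P π (fun s => if s = s₀ then 1 else 0) s * ∑ a, π s a * c s a := by
    rw [← (hV s₀).tsum_eq, tsum_mul_left]
    simp only [Vf, expCost_eq]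
  have hJ := hasSum_sum (s := Finset.univ) fun s₀ _ => (hV s₀).mul_left (ρ₀ s₀)
  refine Eq.trans ?_ (hJ.unique ((hasSum_discounted_expectation hγ hγ' hP hπ hρ
    fun s => ∑ a, π s a * c s a).congr_fun fun t => ?_))
  · simp only [← hVf]
    rw [Jf, Finset.mul_sum]
    exact Finset.sum_congr rfl fun s₀ _ => mul_left_comm _ _ _
  · simp only [stateDist_eq_sum P π ρ₀ t, Finset.sum_mul]
    rw [Finset.sum_comm]
    simp only [Finset.mul_sum]
    refine Finset.sum_congr rfl fun s₀ _ => Finset.sum_congr rfl fun s _ =>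
      Finset.sum_congr rfl fun a _ => ?_
    ring

/-- The performance difference lemma. -/
theorem sum_visit_mul_Adv (hγ : 0 ≤ γ) (hγ' : γ < 1) (hP : IsDynamics P)
    (hπ : IsPolicy π) (hρ : IsDist ρ₀) (c : S → A → ℝ) (η : S → A → ℝ) :
    ∑ s, visit γ P π ρ₀ s * ∑ a, π s a * Adv γ P c η s a =
      (1 - γ) * (Jf γ P c ρ₀ π - Jf γ P c ρ₀ η) := by
  have hA (s : S) : ∑ a, π s a * Adv γ P c η s a = ∑ a, π s a * c s a +
      γ * ∑ a, π s a * ∑ s', P s a s' * Vf γ P c η s' - Vf γ P c η s := by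
    simp only [Adv, Qf, mul_sub, mul_add, Finset.sum_sub_distrib, Finset.sum_add_distrib,
      ← Finset.sum_mul, (hπ s).2, one_mul, mul_left_comm _ γ, ← Finset.mul_sum _ _ γ]
  simp only [hA, mul_sub, mul_add, Finset.sum_sub_distrib, Finset.sum_add_distrib,
    one_sub_mul_Jf hγ hγ' hP hπ hρ, mul_left_comm _ γ, ← Finset.mul_sum _ _ γ]
  rw [sum_visit_mul hγ hγ' hP hπ hρ (Vf γ P c η), Jf]
  ring

end Occupancy

/-- For the statewise mixture `π'_{n+1} = (1-β)π_n + βπ*_n`, if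
`E_{s∼d_{π_n}}[E_{a∼π'_{n+1}(·|s)}[A^{η_n}(s,a)]] ≥ -ξ` and `Δ = J(π_n) - J(η_n) ≥ 0`, then
`E_{s∼d_{π_n}}[E_{a∼π*_n(·|s)}[A^{η_n}(s,a)]] ≥ -ξ/β - (1-γ)Δ/β`. -/
theorem mixture_advantage_lower_bound
    {S A : Type*} [Fintype S] [Fintype A] [DecidableEq S]
    (γ : ℝ) (P : S → A → S → ℝ) (c : S → A → ℝ) (ρ₀ : S → ℝ)
    (hγ : 0 < γ) (hγ' : γ < 1) (hP : IsDynamics P) (hρ : IsDist ρ₀)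
    (hc : ∀ s a, 0 ≤ c s a ∧ c s a ≤ 1)
    (πn ηn πstar : S → A → ℝ)
    (hπn : IsPolicy πn) (hηn : IsPolicy ηn) (hπstar : IsPolicy πstar)
    (β ξ : ℝ) (hβ : 0 < β) (hβ1 : β ≤ 1) (hξ : 0 ≤ ξ)
    (hmix : -ξ ≤ ∑ s, visit γ P πn ρ₀ s *
      ∑ a, ((1 - β) * πn s a + β * πstar s a) * Adv γ P c ηn s a)
    (hΔ : 0 ≤ Jf γ P c ρ₀ πn - Jf γ P c ρ₀ ηn) :
    -ξ / β - (1 - γ) * (Jf γ P c ρ₀ πn - Jf γ P c ρ₀ ηn) / β ≤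
      ∑ s, visit γ P πn ρ₀ s * ∑ a, πstar s a * Adv γ P c ηn s a := by
  have hPD := sum_visit_mul_Adv hγ.le hγ' hP hπn hρ c ηn
  have hsplit : ∑ s, visit γ P πn ρ₀ s *
        ∑ a, ((1 - β) * πn s a + β * πstar s a) * Adv γ P c ηn s a =
      (1 - β) * ∑ s, visit γ P πn ρ₀ s * ∑ a, πn s a * Adv γ P c ηn s a +
        β * ∑ s, visit γ P πn ρ₀ s * ∑ a, πstar s a * Adv γ P c ηn s a := by
    simp only [add_mul, Finset.sum_add_distrib, mul_add, mul_assoc, ← Finset.mul_sum,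
      mul_left_comm (visit γ P πn ρ₀ _)]
  rw [hsplit, hPD] at hmix
  rw [← sub_div, div_le_iff₀ hβ]
  nlinarith [mul_nonneg hβ.le (mul_nonneg (sub_nonneg.2 hγ'.le) hΔ)]
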